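/- In a regular partial magma, if x·y is defined then the left pin of x·y equals the left pin of x and the right pin of x·y equals the right pin of y; moreover x·z is defined if and only if the right pin of x equals the left pin of z (chain rule). -/

import Mathlib

/-- A unit of a partial binary operation `op`. -/
def IsUnitOf {B : Type*} (op : B → B → Option B) (u : B) : Prop :=
  (op u u).isSome ∧ (∀ y z, op u y = some z → z = y) ∧ (∀ y z, op y u = some z → z = y)

/-- Strong (Kleene) associativity of a partial binary operation. -/
def StrongAssoc {B : Type*} (op : B → B → Option B) : Prop :=
  ∀ x y z : B,
    ((op x y).bind (fun p => op p z) = (op y z).bind (fun q => op x q)) ∧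
    (((op x y).bind (fun p => op p z)).isSome ↔ (op x y).isSome ∧ (op y z).isSome)

/-- Fastened: every element has a left pin and a right pin. -/
def Fastened {B : Type*} (op : B → B → Option B) : Prop :=
  ∀ x : B, (∃ l, IsUnitOf op l ∧ (op l x).isSome) ∧ (∃ r, IsUnitOf op r ∧ (op x r).isSome)

/-- Left multiplication by `u` is defined on a product iff it is defined on the left factor. -/
theorem StrongAssoc.isSome_left {B : Type*} {op : B → B → Option B} (hA : StrongAssoc op)
    {x y z : B} (h : op x y = some z) (u : B) : (op u z).isSome ↔ (op u x).isSome := by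
  have hu := hA u x y
  rw [hu.1] at hu
  simpa [h] using hu.2

/-- Right multiplication by `u` is defined on a product iff it is defined on the right factor. -/
theorem StrongAssoc.isSome_right {B : Type*} {op : B → B → Option B} (hA : StrongAssoc op)
    {x y z : B} (h : op x y = some z) (u : B) : (op z u).isSome ↔ (op y u).isSome := by
  simpa [h] using (hA x y u).2

/-- A unit `u` acts as a right identity wherever `x·u` is defined. -/
theorem IsUnitOf.op_eq_some {B : Type*} {op : B → B → Option B} {u x : B}
    (hu : IsUnitOf op u) (h : (op x u).isSome) : op x u = some x := by
  obtain ⟨z, hz⟩ := Option.isSome_iff_exists.1 h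
  rw [hz, hu.2.2 x z hz]

/-- In a regular partial magma: the left pin of a product is the left pin of the
left factor, the right pin of a product is the right pin of the right factor, and
the chain rule: `x·z` is defined iff some unit is simultaneously a right pin of `x`
and a left pin of `z`. -/
theorem regular_pins_of_product_and_chain_rule {B : Type*} (op : B → B → Option B)
    (hA : StrongAssoc op) (hU : ∃ u, IsUnitOf op u) (hΦ : Fastened op) :
    (∀ x y z : B, op x y = some z →
      (∀ u : B, (IsUnitOf op u ∧ (op u z).isSome) ↔ (IsUnitOf op u ∧ (op u x).isSome)) ∧
      (∀ u : B, (IsUnitOf op u ∧ (op z u).isSome) ↔ (IsUnitOf op u ∧ (op y u).isSome))) ∧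
    (∀ x z : B, (op x z).isSome ↔
      ∃ u : B, IsUnitOf op u ∧ (op x u).isSome ∧ (op u z).isSome) := by
  refine ⟨fun x y z h => ⟨fun u => and_congr_right fun _ => hA.isSome_left h u,
    fun u => and_congr_right fun _ => hA.isSome_right h u⟩, fun x z => ⟨fun h => ?_, ?_⟩⟩
  · obtain ⟨r, hr, hxr⟩ := (hΦ x).2
    exact ⟨r, hr, hxr, (hA.isSome_right (hr.op_eq_some hxr) z).1 h⟩
  · rintro ⟨u, hu, hxu, huz⟩
    exact (hA.isSome_right (hu.op_eq_some hxu) z).2 huz
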